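/- Let F : ℝ⁴ → (Fin 4 → Fin 4 → ℝ) be smooth and compactly supported, with F_{μν}(x) = −F_{νμ}(x) for all x, μ, ν, and satisfying the Bianchi identity ∂_λ F_{μν} + ∂_μ F_{νλ} + ∂_ν F_{λμ} = 0 for all indices λ, μ, ν and all x. Let e ∈ ℝ⁴ be nonzero, and define A_μ(x) := ∫₀^∞ ∑_ν F_{μν}(x + t·e) e_ν dt (the integral converges since F has compact support). Then A is smooth and ∂_μ A_ν(x) − ∂_ν A_μ(x) = F_{μν}(x) for all x, μ, ν. -/

import Mathlib

open MeasureTheory Set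

/-- Partial derivative in the `ρ`-th coordinate direction of `ℝ⁴`. -/
noncomputable def pd (ρ : Fin 4) (g : (Fin 4 → ℝ) → ℝ) (x : Fin 4 → ℝ) : ℝ :=
  fderiv ℝ g x (Pi.single ρ 1)


lemma ray_hcs {H : Type} [NormedAddCommGroup H] (e : Fin 4 → ℝ) (he : e ≠ 0)
    (G : (Fin 4 → ℝ) → H) (hs : HasCompactSupport G) (x : Fin 4 → ℝ) :
    HasCompactSupport (fun t : ℝ => G (x + t • e)) := by
  have h1 : Topology.IsClosedEmbedding (fun t : ℝ => t • e) :=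
    isClosedEmbedding_smul_left he
  have h2 : Topology.IsClosedEmbedding (fun t : ℝ => x + t • e) :=
    (Homeomorph.addLeft x).isClosedEmbedding.comp h1
  exact hs.comp_isClosedEmbedding h2

lemma ray_integrable {H : Type} [NormedAddCommGroup H] (e : Fin 4 → ℝ)
    (he : e ≠ 0) (G : (Fin 4 → ℝ) → H) (hG : Continuous G) (hs : HasCompactSupport G)
    (x : Fin 4 → ℝ) :
    Integrable (fun t : ℝ => G (x + t • e)) (volume.restrict (Ioi 0)) := by
  refine Integrable.restrict ?_
  exact Continuous.integrable_of_hasCompactSupport (by fun_prop) (ray_hcs e he G hs x)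

lemma ray_bound {H : Type} [NormedAddCommGroup H] (e : Fin 4 → ℝ)
    (he : e ≠ 0) (G : (Fin 4 → ℝ) → H) (hG : Continuous G) (hs : HasCompactSupport G)
    (x₀ : Fin 4 → ℝ) :
    ∃ b : ℝ → ℝ, Integrable b (volume.restrict (Ioi (0:ℝ))) ∧
      ∀ t ∈ Ioi (0:ℝ), ∀ x ∈ Metric.ball x₀ 1, ‖G (x + t • e)‖ ≤ b t := by
  obtain ⟨C, hC⟩ := hG.bounded_above_of_compact_support hs
  obtain ⟨M, hM⟩ := hs.isCompact.isBounded.exists_norm_le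
  have hep : 0 < ‖e‖ := norm_pos_iff.mpr he
  set R : ℝ := (M + ‖x₀‖ + 1) / ‖e‖ with hR
  refine ⟨(Icc 0 R).indicator (fun _ => C), ?_, ?_⟩
  · refine Integrable.restrict ?_
    rw [integrable_indicator_iff measurableSet_Icc]
    exact integrableOn_const (by simp)
  · intro t ht x hx
    by_cases htR : t ≤ R
    · rw [indicator_of_mem (show t ∈ Icc 0 R from ⟨le_of_lt ht, htR⟩)]
      exact hC _
    · rw [indicator_of_notMem (fun h => htR h.2)]
      have : G (x + t • e) = 0 := by
        by_contra hne
        have h1 := hM _ (subset_tsupport G hne)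
        have h2 : ‖t • e‖ = t * ‖e‖ := by
          rw [norm_smul, Real.norm_of_nonneg (le_of_lt ht)]
        have h3 : ‖t • e‖ ≤ ‖x + t • e‖ + ‖x‖ := by
          have := norm_sub_le (x + t • e) x
          simpa using this
        have h4 : ‖x‖ ≤ ‖x₀‖ + 1 := by
          have h5 : ‖x - x₀‖ < 1 := by simpa [dist_eq_norm] using hx
          have := norm_sub_norm_le x x₀
          linarith
        push Not at htR
        rw [hR, div_lt_iff₀ hep] at htR
        linarith
      simp [this]

lemma ray_hasFDerivAt {H : Type} [NormedAddCommGroup H] [NormedSpace ℝ H]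
    (e : Fin 4 → ℝ) (he : e ≠ 0) (G : (Fin 4 → ℝ) → H) (hG : ContDiff ℝ 1 G)
    (hs : HasCompactSupport G) (x₀ : Fin 4 → ℝ) :
    HasFDerivAt (fun x => ∫ t in Ioi (0:ℝ), G (x + t • e))
      (∫ t in Ioi (0:ℝ), fderiv ℝ G (x₀ + t • e)) x₀ := by
  have hc : Continuous (fderiv ℝ G) := hG.continuous_fderiv one_ne_zero
  obtain ⟨b, hb, hb'⟩ := ray_bound e he (fderiv ℝ G) hc (hs.fderiv ℝ) x₀
  refine hasFDerivAt_integral_of_dominated_of_fderiv_le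
    (F := fun x t => G (x + t • e)) (F' := fun x t => fderiv ℝ G (x + t • e))
    (bound := b) (Metric.ball_mem_nhds x₀ one_pos) ?_ ?_ ?_ ?_ hb ?_
  · exact Filter.Eventually.of_forall fun x =>
      (ray_integrable e he G hG.continuous hs x).aestronglyMeasurable
  · exact ray_integrable e he G hG.continuous hs x₀
  · exact (ray_integrable e he _ hc (hs.fderiv ℝ) x₀).aestronglyMeasurable
  · exact (ae_restrict_iff' measurableSet_Ioi).mpr (Filter.Eventually.of_forall hb')
  · refine Filter.Eventually.of_forall fun t x _ => ?_
    have h := ((hG.differentiable one_ne_zero) (x + t • e)).hasFDerivAt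
    have h3 : HasFDerivAt (fun x : Fin 4 → ℝ => x + t • e)
        (ContinuousLinearMap.id ℝ (Fin 4 → ℝ)) x := (hasFDerivAt_id x).add_const _
    simpa [Function.comp_def] using h.comp x h3

lemma ray_contDiff_nat (e : Fin 4 → ℝ) (he : e ≠ 0) (n : ℕ) :
    ∀ {H : Type} [NormedAddCommGroup H] [NormedSpace ℝ H]
    (G : (Fin 4 → ℝ) → H), ContDiff ℝ (⊤ : ℕ∞) G → HasCompactSupport G →
    ContDiff ℝ n (fun x => ∫ t in Ioi (0:ℝ), G (x + t • e)) := by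
  induction n with
  | zero =>
    intro H _ _ G hG hs
    refine contDiff_zero.mpr (continuous_iff_continuousAt.mpr fun x => ?_)
    exact (ray_hasFDerivAt e he G (hG.of_le (by exact_mod_cast le_top)) hs x).continuousAt
  | succ n ih =>
    intro H _ _ G hG hs
    have hd := ray_hasFDerivAt e he G (hG.of_le (by exact_mod_cast le_top)) hs
    push_cast
    rw [contDiff_succ_iff_fderiv]
    refine ⟨fun x => (hd x).differentiableAt, by simp, ?_⟩
    have : fderiv ℝ (fun x => ∫ t in Ioi (0:ℝ), G (x + t • e))
        = fun x => ∫ t in Ioi (0:ℝ), fderiv ℝ G (x + t • e) := funext fun x => (hd x).fderiv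
    rw [this]
    exact ih _ (hG.fderiv_right (by simp)) (hs.fderiv ℝ)

lemma ray_ftc (e : Fin 4 → ℝ) (he : e ≠ 0) (f : (Fin 4 → ℝ) → ℝ) (hf : ContDiff ℝ 1 f)
    (hs : HasCompactSupport f) (x : Fin 4 → ℝ) :
    ∫ t in Ioi (0:ℝ), fderiv ℝ f (x + t • e) e = - f x := by
  have h := HasCompactSupport.integral_Ioi_deriv_eq
    (f := fun t : ℝ => f (x + t • e)) (by fun_prop) (ray_hcs e he f hs x) 0
  have h2 : ∀ t : ℝ, deriv (fun t : ℝ => f (x + t • e)) t = fderiv ℝ f (x + t • e) e := by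
    intro t
    have h3 : HasDerivAt (fun t : ℝ => x + t • e) e t := by
      simpa using ((hasDerivAt_id t).smul_const e).const_add x
    exact (((hf.differentiable one_ne_zero) (x + t • e)).hasFDerivAt.comp_hasDerivAt t h3).deriv
  simpa [h2] using h

/-- for a smooth, compactly supported, antisymmetric field
strength `F` satisfying the Bianchi identity, the line integral
`A_μ(x) = ∫₀^∞ ∑_ν F_{μν}(x + t e) e_ν dt` along the ray in the nonzero
direction `e` is smooth and is a vector potential for `F`:
`∂_μ A_ν − ∂_ν A_μ = F_{μν}`. -/
theorem string_integral_is_potential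
    (F : (Fin 4 → ℝ) → Fin 4 → Fin 4 → ℝ)
    (hF : ContDiff ℝ (⊤ : ℕ∞) F) (hsupp : HasCompactSupport F)
    (hanti : ∀ x μ ν, F x μ ν = - F x ν μ)
    (hBianchi : ∀ x lam μ ν,
      pd lam (fun y => F y μ ν) x + pd μ (fun y => F y ν lam) x
        + pd ν (fun y => F y lam μ) x = 0)
    (e : Fin 4 → ℝ) (he : e ≠ 0)
    (A : Fin 4 → (Fin 4 → ℝ) → ℝ)
    (hA : ∀ μ x, A μ x = ∫ t in Ioi (0:ℝ), ∑ ν, F (x + t • e) μ ν * e ν) :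
    (∀ μ, ContDiff ℝ (⊤ : ℕ∞) (A μ)) ∧
    (∀ x μ ν, pd μ (A ν) x - pd ν (A μ) x = F x μ ν) := by
  have hFc : ∀ μ ν, ContDiff ℝ (⊤ : ℕ∞) (fun y => F y μ ν) := fun μ ν => by
    have h1 := contDiff_pi.mp hF μ
    exact contDiff_pi.mp h1 ν
  have hFs : ∀ μ ν, HasCompactSupport (fun y => F y μ ν) := fun μ ν =>
    hsupp.comp_left (g := fun M : Fin 4 → Fin 4 → ℝ => M μ ν) rfl
  set G : Fin 4 → (Fin 4 → ℝ) → ℝ := fun μ y => ∑ ν, F y μ ν * e ν with hGdef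
  have hGc : ∀ μ, ContDiff ℝ (⊤ : ℕ∞) (G μ) := fun μ =>
    ContDiff.sum fun ν _ => (hFc μ ν).mul contDiff_const
  have hGs : ∀ μ, HasCompactSupport (G μ) := fun μ =>
    hsupp.comp_left (g := fun M : Fin 4 → Fin 4 → ℝ => ∑ ν, M μ ν * e ν) (by simp)
  have h1 : (1 : WithTop ℕ∞) ≤ ((⊤ : ℕ∞) : WithTop ℕ∞) := by exact_mod_cast le_top
  have hAG : ∀ μ, A μ = fun x => ∫ t in Ioi (0:ℝ), G μ (x + t • e) := fun μ =>
    funext fun x => hA μ x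
  refine ⟨fun μ => ?_, fun x μ ν => ?_⟩
  · rw [hAG, contDiff_infty]
    exact fun n => ray_contDiff_nat e he n (G μ) (hGc μ) (hGs μ)
  · have hint : ∀ ν, Integrable (fun t : ℝ => fderiv ℝ (G ν) (x + t • e))
        (volume.restrict (Ioi 0)) := fun ν =>
      ray_integrable e he _ (((hGc ν).of_le h1).continuous_fderiv one_ne_zero)
        ((hGs ν).fderiv ℝ) x
    have hpd : ∀ μ ν, pd μ (A ν) x
        = ∫ t in Ioi (0:ℝ), fderiv ℝ (G ν) (x + t • e) (Pi.single μ 1) := by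
      intro μ ν
      rw [pd, hAG, (ray_hasFDerivAt e he (G ν) ((hGc ν).of_le h1) (hGs ν) x).fderiv]
      exact ContinuousLinearMap.integral_apply (hint ν) _
    have hGpd : ∀ μ ν y, fderiv ℝ (G ν) y (Pi.single μ 1)
        = ∑ l, pd μ (fun y => F y ν l) y * e l := by
      intro μ ν y
      have h : HasFDerivAt (G ν) (∑ l, e l • fderiv ℝ (fun y => F y ν l) y) y := by
        refine HasFDerivAt.fun_sum fun l _ => ?_
        exact (((hFc ν l).of_le h1).differentiable one_ne_zero y).hasFDerivAt.mul_const (e l)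
      rw [h.fderiv]
      simp [pd, mul_comm]
    have hdir : ∀ y, fderiv ℝ (fun y => F y μ ν) y e
        = ∑ l, pd l (fun y => F y μ ν) y * e l := by
      intro y
      conv_lhs => rw [pi_eq_sum_univ' e]
      rw [map_sum]
      refine Finset.sum_congr rfl fun l _ => ?_
      rw [map_smul, pd, smul_eq_mul, mul_comm]
    rw [hpd, hpd, ← integral_sub ((hint ν).apply_continuousLinearMap _)
      ((hint μ).apply_continuousLinearMap _)]
    have hpt : ∀ y, fderiv ℝ (G ν) y (Pi.single μ 1) - fderiv ℝ (G μ) y (Pi.single ν 1)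
        = - fderiv ℝ (fun y => F y μ ν) y e := by
      intro y
      rw [hGpd, hGpd, hdir, ← Finset.sum_sub_distrib, ← Finset.sum_neg_distrib]
      refine Finset.sum_congr rfl fun l _ => ?_
      have hb := hBianchi y l μ ν
      have ha : pd ν (fun y => F y l μ) y = - pd ν (fun y => F y μ l) y := by
        have : (fun y => F y l μ) = fun y => - F y μ l := funext fun y => hanti y l μ
        rw [this, pd, pd, fderiv_fun_neg]
        rfl
      rw [ha] at hb
      linear_combination e l * hb
    simp only [hpt]
    rw [integral_neg, ray_ftc e he _ ((hFc μ ν).of_le h1) (hFs μ ν), neg_neg]
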